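/- Let A be an extremal d-dimensional (0,1)-matrix of order n with deficiency δ and let Λ be an optimal hyperplane cover of A. Suppose β is an index with a_β = 0 and there exists an index α with ∑_{i=1}^d λ_{i,α_i} = 1 − δ such that λ_{i,β_i} ≤ λ_{i,α_i} for all i = 1,…,d. Then there exists a polyplex K contained in A of weight n − 1 such that k_γ = 0 for every index γ sharing a coordinate with β (i.e., γ_i = β_i for some i); equivalently, the submatrix of order n−1 obtained from A by deleting all hyperplanes containing β has a polydiagonal. -/

import Mathlib

open Finset

/-- A d-dimensional matrix of order n is a (0,1)-matrix if all entries are 0 or 1. -/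
def IsZeroOne {d n : ℕ} (A : (Fin d → Fin n) → ℝ) : Prop :=
  ∀ α, A α = 0 ∨ A α = 1

/-- A polyplex: nonnegative entries, each hyperplane sum at most 1. -/
def IsPolyplex {d n : ℕ} (K : (Fin d → Fin n) → ℝ) : Prop :=
  (∀ α, 0 ≤ K α) ∧
  ∀ (i : Fin d) (j : Fin n),
    (∑ α : Fin d → Fin n, if α i = j then K α else 0) ≤ 1

/-- The weight of a polyplex: the sum of all its entries. -/
def plexWeight {d n : ℕ} (K : (Fin d → Fin n) → ℝ) : ℝ := ∑ α, K α

/-- K is contained in A: supp(K) ⊆ supp(A). -/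
def ContainedIn {d n : ℕ} (K A : (Fin d → Fin n) → ℝ) : Prop :=
  ∀ α, K α ≠ 0 → A α ≠ 0

/-- The set of weights of polyplexes contained in A. -/
def polyplexWeights {d n : ℕ} (A : (Fin d → Fin n) → ℝ) : Set ℝ :=
  {W | ∃ K, IsPolyplex K ∧ ContainedIn K A ∧ plexWeight K = W}

/-- A contains a polydiagonal: a polyplex of weight n. -/
def HasPolydiagonal {d n : ℕ} (A : (Fin d → Fin n) → ℝ) : Prop :=
  ∃ K, IsPolyplex K ∧ ContainedIn K A ∧ plexWeight K = (n : ℝ)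

/-- A is extremal: no polydiagonal, but changing any zero entry to 1 creates one. -/
def IsExtremal {d n : ℕ} (A : (Fin d → Fin n) → ℝ) : Prop :=
  ¬ HasPolydiagonal A ∧
  ∀ α, A α = 0 → HasPolydiagonal (Function.update A α (1 : ℝ))

/-- A hyperplane cover of A: nonnegative weights on hyperplanes covering supp(A). -/
def IsCover {d n : ℕ} (A : (Fin d → Fin n) → ℝ) (Λ : Fin d → Fin n → ℝ) : Prop :=
  (∀ i j, 0 ≤ Λ i j) ∧ ∀ α, A α ≠ 0 → 1 ≤ ∑ i, Λ i (α i)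

/-- The weight of a hyperplane cover. -/
def coverWeight {d n : ℕ} (Λ : Fin d → Fin n → ℝ) : ℝ := ∑ i, ∑ j, Λ i j

/-- The set of weights of hyperplane covers of A. -/
def coverWeights {d n : ℕ} (A : (Fin d → Fin n) → ℝ) : Set ℝ :=
  {W | ∃ Λ : Fin d → Fin n → ℝ, IsCover A Λ ∧ coverWeight Λ = W}

/-- Λ is an optimal hyperplane cover of A. -/
def IsOptimalCover {d n : ℕ} (A : (Fin d → Fin n) → ℝ) (Λ : Fin d → Fin n → ℝ) : Prop :=
  IsCover A Λ ∧ ∀ Λ' : Fin d → Fin n → ℝ, IsCover A Λ' → coverWeight Λ ≤ coverWeight Λ'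

/-- K is an optimal polyplex contained in A. -/
def IsOptimalPolyplex {d n : ℕ} (A K : (Fin d → Fin n) → ℝ) : Prop :=
  IsPolyplex K ∧ ContainedIn K A ∧
  ∀ K' : (Fin d → Fin n) → ℝ, IsPolyplex K' → ContainedIn K' A → plexWeight K' ≤ plexWeight K

/-- A(Λ): the (0,1)-matrix of indices covered with weight at least 1 by Λ. -/
noncomputable def matOf {d n : ℕ} (Λ : Fin d → Fin n → ℝ) : (Fin d → Fin n) → ℝ :=
  fun α => if 1 ≤ ∑ i, Λ i (α i) then (1 : ℝ) else 0

/-- A has deficiency δ: the maximum weight of a polyplex contained in A is n − δ. -/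
def HasDeficiency {d n : ℕ} (A : (Fin d → Fin n) → ℝ) (δ : ℝ) : Prop :=
  IsGreatest (polyplexWeights A) ((n : ℝ) - δ)

/-- Weak duality between polyplexes and covers: weighting each entry of a polyplex by the
cover sum of its index gives at most the weight of the cover. -/
theorem IsPolyplex.sum_mul_le_coverWeight {d n : ℕ} {K : (Fin d → Fin n) → ℝ} (hK : IsPolyplex K)
    {Λ : Fin d → Fin n → ℝ} (hΛ : ∀ i j, 0 ≤ Λ i j) :
    ∑ γ, K γ * ∑ i, Λ i (γ i) ≤ coverWeight Λ := by
  have h : ∑ γ, K γ * ∑ i, Λ i (γ i)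
      = ∑ i, ∑ j, Λ i j * ∑ γ : Fin d → Fin n, if γ i = j then K γ else 0 := by
    simp_rw [Finset.mul_sum]
    rw [Finset.sum_comm]
    refine Finset.sum_congr rfl fun i _ => ?_
    rw [Finset.sum_comm]
    refine Finset.sum_congr rfl fun γ _ => ?_
    simp [mul_comm]
  rw [h]
  refine Finset.sum_le_sum fun i _ => Finset.sum_le_sum fun j _ => ?_
  simpa using mul_le_mul_of_nonneg_left (hK.2 i j) (hΛ i j)

/-- In positive dimension a polyplex of order `n` has weight at most `n`. -/
theorem IsPolyplex.plexWeight_le {d n : ℕ} {K : (Fin d → Fin n) → ℝ} (hK : IsPolyplex K)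
    (i : Fin d) : plexWeight K ≤ n := by
  have h : plexWeight K = ∑ j : Fin n, ∑ γ : Fin d → Fin n, if γ i = j then K γ else 0 := by
    rw [Finset.sum_comm]
    simp [plexWeight]
  rw [h]
  exact (Finset.sum_le_sum fun j _ => hK.2 i j).trans (by simp)

/-- Two distinct indices in a common hyperplane have entries with sum at most one. -/
theorem IsPolyplex.add_le_one {d n : ℕ} {K : (Fin d → Fin n) → ℝ} (hK : IsPolyplex K)
    {α γ : Fin d → Fin n} (hne : γ ≠ α) {i : Fin d} (hi : γ i = α i) : K γ + K α ≤ 1 := by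
  classical
  refine le_trans ?_ (hK.2 i (α i))
  rw [← Finset.sum_filter, ← Finset.sum_pair hne]
  refine Finset.sum_le_sum_of_subset_of_nonneg ?_ fun γ' _ _ => hK.1 γ'
  intro γ' h
  rcases Finset.mem_insert.1 h with rfl | h
  · simpa using hi
  · simp [Finset.mem_singleton.1 h]

/-- Every entry of a polyplex is at most one in positive dimension. -/
theorem IsPolyplex.le_one {d n : ℕ} {K : (Fin d → Fin n) → ℝ} (hK : IsPolyplex K)
    (i : Fin d) (α : Fin d → Fin n) : K α ≤ 1 := by
  refine le_trans ?_ (hK.2 i (α i))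
  rw [← Finset.sum_filter]
  exact Finset.single_le_sum (fun γ _ => hK.1 γ) (by simp)

/-- Linear programming duality: if every polyplex in a nonzero matrix `A` has weight less than `M`,
then `A` has a hyperplane cover of weight `M`. -/
theorem exists_isCover_coverWeight_eq {d n : ℕ} {A : (Fin d → Fin n) → ℝ} {M : ℝ} (hM : 0 < M)
    (hA : ∃ γ, A γ ≠ 0)
    (h : ∀ K, IsPolyplex K → ContainedIn K A → plexWeight K < M) :
    ∃ Λ, IsCover A Λ ∧ coverWeight Λ = M := by
  classical
  let L : ((Fin d → Fin n) → ℝ) →ₗ[ℝ] (Fin d × Fin n → ℝ) :=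
    { toFun := fun K p => ∑ γ : Fin d → Fin n, if γ p.1 = p.2 then K γ else 0
      map_add' := by
        intro K K'
        ext p
        simp [Finset.sum_ite, Finset.sum_add_distrib]
      map_smul' := by
        intro c K
        ext p
        simp [Finset.sum_ite, Finset.mul_sum] }
  have hL : ∀ K p, L K p = ∑ γ : Fin d → Fin n, if γ p.1 = p.2 then K γ else 0 :=
    fun _ _ => rfl
  let T : Set ((Fin d → Fin n) → ℝ) :=
    stdSimplex ℝ (Fin d → Fin n) ∩ {K | ∀ γ, A γ = 0 → K γ = 0}
  have hTconv : Convex ℝ T := by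
    refine (convex_stdSimplex ℝ _).inter ?_
    intro K hK K' hK' a b _ _ _ γ hγ
    simp [hK γ hγ, hK' γ hγ]
  have hTcomp : IsCompact T := by
    refine (isCompact_stdSimplex ℝ _).inter_right ?_
    simp only [Set.ofPred_forall]
    exact isClosed_iInter fun γ => isClosed_iInter fun _ =>
      isClosed_eq (continuous_apply γ) continuous_const
  let s : Set (Fin d × Fin n → ℝ) := Set.Iic fun _ => M⁻¹
  have hdisj : Disjoint s (L '' T) := by
    rw [Set.disjoint_right]
    rintro _ ⟨K, ⟨⟨hK0, hK1⟩, hKA⟩, rfl⟩ hs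
    have hlt := h (M • K) ⟨fun γ => mul_nonneg hM.le (hK0 γ), fun i j => ?_⟩ ?_
    · simp [plexWeight, ← Finset.mul_sum, hK1] at hlt
    · have h1 : L K (i, j) ≤ M⁻¹ := hs (i, j)
      have h2 : (∑ γ : Fin d → Fin n, if γ i = j then (M • K) γ else 0) = M * L K (i, j) := by
        simp [hL, Finset.mul_sum]
      rw [h2]
      calc M * L K (i, j) ≤ M * M⁻¹ := mul_le_mul_of_nonneg_left h1 hM.le
        _ = 1 := mul_inv_cancel₀ hM.ne'
    · intro γ hγ hAγ
      exact hγ (by simp [hKA γ hAγ])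
  obtain ⟨f, u, v, hfu, huv, hfv⟩ := geometric_hahn_banach_closed_compact (convex_Iic _)
    isClosed_Iic (hTconv.linear_image L)
    (hTcomp.image (LinearMap.continuous_of_finiteDimensional L)) hdisj
  let c : Fin d × Fin n → ℝ := fun p => f (Pi.single p 1)
  have hf : ∀ x, f x = ∑ p, x p * c p := by
    intro x
    have := LinearMap.pi_apply_eq_sum_univ f.toLinearMap x
    simp only [smul_eq_mul] at this
    refine this.trans (Finset.sum_congr rfl fun p _ => ?_)
    have hp : (Pi.single p 1 : Fin d × Fin n → ℝ) = fun q => if p = q then 1 else 0 := by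
      ext q
      simp [Pi.single_apply, eq_comm]
    simp only [c, hp]
    rfl
  have hS : M⁻¹ * ∑ p, c p < u := by
    have := hfu (fun _ => M⁻¹) (Set.mem_Iic.2 le_rfl)
    rwa [hf, ← Finset.mul_sum] at this
  have hc : ∀ p, 0 ≤ c p := by
    intro p
    by_contra! hneg
    obtain ⟨N, hN⟩ := exists_nat_gt ((u - M⁻¹ * ∑ p, c p) / (-c p))
    rw [div_lt_iff₀ (by linarith)] at hN
    have := hfu ((fun _ => M⁻¹) - (N : ℝ) • Pi.single p 1) (by
      intro q
      simp only [Pi.sub_apply, Pi.smul_apply, Pi.single_apply, smul_eq_mul]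
      split_ifs <;> simp)
    rw [map_sub, map_smul, hf, ← Finset.mul_sum, smul_eq_mul] at this
    change _ - (N : ℝ) * c p < u at this
    linarith
  have hγ : ∀ γ, A γ ≠ 0 → M⁻¹ * ∑ p, c p < ∑ i, c (i, γ i) := by
    intro γ hγ
    have h1 := hfv (L (Pi.single γ 1)) ⟨_, ⟨single_mem_stdSimplex ℝ γ, fun γ' h' => by
      have : γ' ≠ γ := by rintro rfl; exact hγ h'
      simp [this]⟩, rfl⟩
    have h2 : f (L (Pi.single γ 1)) = ∑ i, c (i, γ i) := by
      rw [hf, Fintype.sum_prod_type]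
      refine Finset.sum_congr rfl fun i _ => ?_
      have h3 : ∀ j, L (Pi.single γ 1) (i, j) = if γ i = j then 1 else 0 := by
        intro j
        rw [hL, Finset.sum_eq_single γ]
        · simp
        · intro γ' _ hne
          simp [hne]
        · simp
      simp [h3]
    linarith
  have hSpos : 0 < ∑ p, c p := by
    refine (Finset.sum_nonneg fun p _ => hc p).lt_of_ne fun h0 => ?_
    obtain ⟨γ, hAγ⟩ := hA
    have h1 := hγ γ hAγ
    have h2 : ∀ p, c p = 0 := fun p =>
      (Finset.sum_eq_zero_iff_of_nonneg fun p _ => hc p).1 h0.symm p (Finset.mem_univ p)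
    simp [h2] at h1
  refine ⟨fun i j => M / (∑ p, c p) * c (i, j), ⟨fun i j => mul_nonneg (by positivity) (hc _),
    fun γ hAγ => ?_⟩, ?_⟩
  · rw [← Finset.mul_sum]
    have h1 := mul_le_mul_of_nonneg_left (hγ γ hAγ).le (div_pos hM hSpos).le
    refine le_trans (le_of_eq ?_) h1
    field_simp
  · simp only [coverWeight, ← Finset.mul_sum]
    rw [← Fintype.sum_prod_type]
    exact div_mul_cancel₀ M hSpos.ne'

/-- The weight of an optimal cover is at most the order minus the deficiency. -/
theorem IsOptimalCover.coverWeight_le {d n : ℕ} {A : (Fin d → Fin n) → ℝ}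
    {Λ : Fin d → Fin n → ℝ} (hΛ : IsOptimalCover A Λ) {δ : ℝ} (hδ : HasDeficiency A δ) :
    coverWeight Λ ≤ n - δ := by
  have h0 : (0 : ℝ) ≤ n - δ := hδ.2 ⟨0, ⟨by simp, by simp⟩, by simp [ContainedIn], by
    simp [plexWeight]⟩
  by_cases hA : ∃ γ, A γ ≠ 0
  · refine le_of_forall_gt_imp_ge_of_dense fun M hM => ?_
    obtain ⟨Λ', hΛ', rfl⟩ := exists_isCover_coverWeight_eq (h0.trans_lt hM) hA
      fun K hK hKA => (hδ.2 ⟨K, hK, hKA, rfl⟩).trans_lt hM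
    exact hΛ.2 Λ' hΛ'
  · push Not at hA
    refine (hΛ.2 (fun _ _ => 0) ⟨by simp, fun γ hγ => absurd (hA γ) hγ⟩).trans ?_
    simpa [coverWeight] using h0

/-- A cover of an extremal matrix with weight less than the order covers only the support. -/
theorem IsExtremal.ne_zero_of_one_le {d n : ℕ} {A : (Fin d → Fin n) → ℝ} (hE : IsExtremal A)
    {Λ : Fin d → Fin n → ℝ} (hΛ : IsCover A Λ) (hw : coverWeight Λ < n)
    {γ : Fin d → Fin n} (hγ : 1 ≤ ∑ i, Λ i (γ i)) : A γ ≠ 0 := by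
  intro h0
  obtain ⟨D, hD, hDA, hDw⟩ := hE.2 γ h0
  have h1 := hD.sum_mul_le_coverWeight hΛ.1
  have h2 : plexWeight D ≤ ∑ γ, D γ * ∑ i, Λ i (γ i) := by
    refine Finset.sum_le_sum fun γ' _ => ?_
    by_cases hz : D γ' = 0
    · simp [hz]
    · refine le_mul_of_one_le_right (hD.1 γ') ?_
      have := hDA γ' hz
      by_cases he : γ' = γ
      · rwa [he]
      · exact hΛ.2 γ' (by simpa [he] using this)
  linarith

/-- If the cover sum at `α` attains one minus the deficiency, then the submatrix avoiding `α` has a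
polydiagonal. -/
theorem IsExtremal.exists_polyplex_avoiding {d n : ℕ} {A : (Fin d → Fin n) → ℝ}
    (hE : IsExtremal A) {Λ : Fin d → Fin n → ℝ} (hΛ : IsCover A Λ) {δ : ℝ} (hδ : 0 < δ)
    (hw : coverWeight Λ ≤ n - δ) (i₀ : Fin d) {α : Fin d → Fin n}
    (hα : ∑ i, Λ i (α i) = 1 - δ) (hAα : A α = 0) :
    ∃ K : (Fin d → Fin n) → ℝ,
      IsPolyplex K ∧ ContainedIn K A ∧ plexWeight K = (n : ℝ) - 1 ∧
      ∀ γ : Fin d → Fin n, (∃ i, γ i = α i) → K γ = 0 := by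
  obtain ⟨D, hD, hDA, hDw⟩ := hE.2 α hAα
  have hDα : D α = 1 := by
    refine le_antisymm (hD.le_one i₀ α) ?_
    have h1 := hD.sum_mul_le_coverWeight hΛ.1
    have h2 : ∑ γ, (D γ - if γ = α then δ * D α else 0) ≤ ∑ γ, D γ * ∑ i, Λ i (γ i) := by
      refine Finset.sum_le_sum fun γ _ => ?_
      by_cases he : γ = α
      · subst he
        simp only [if_true, hα]
        exact le_of_eq (by ring)
      · simp only [he, if_false, sub_zero]
        by_cases hz : D γ = 0
        · simp [hz]
        · exact le_mul_of_one_le_right (hD.1 γ)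
            (hΛ.2 γ (by simpa [he] using hDA γ hz))
    rw [Finset.sum_sub_distrib, Finset.sum_ite_eq' Finset.univ α, if_pos (Finset.mem_univ _)] at h2
    change plexWeight D - _ ≤ _ at h2
    rw [hDw] at h2
    by_contra! hlt
    nlinarith
  refine ⟨fun γ => D γ - if γ = α then 1 else 0, ⟨fun γ => ?_, fun i j => ?_⟩, fun γ hγ => ?_, ?_,
    ?_⟩
  · by_cases he : γ = α
    · simp [he, hDα]
    · simpa [he] using hD.1 γ
  · refine le_trans (Finset.sum_le_sum fun γ _ => ?_) (hD.2 i j)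
    grind
  · by_cases he : γ = α
    · simp [he, hDα] at hγ
    · simp only [he, if_false, sub_zero] at hγ
      simpa [he] using hDA γ hγ
  · rw [← hDw]
    simp [plexWeight, Finset.sum_sub_distrib]
  · rintro γ ⟨i, hi⟩
    by_cases he : γ = α
    · simp [he, hDα]
    · have h1 := hD.add_le_one he hi
      have h2 := hD.1 γ
      simp only [he, if_false, sub_zero]
      linarith

/-- a polydiagonal exists in the submatrix avoiding β. -/
theorem stmt_17 (d n : ℕ) (A : (Fin d → Fin n) → ℝ) (hA : IsZeroOne A)
    (hE : IsExtremal A) (δ : ℝ) (hδ : HasDeficiency A δ)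
    (Λ : Fin d → Fin n → ℝ) (hΛ : IsOptimalCover A Λ)
    (β : Fin d → Fin n) (hβ : A β = 0)
    (α : Fin d → Fin n) (hα : ∑ i, Λ i (α i) = 1 - δ)
    (hle : ∀ i, Λ i (β i) ≤ Λ i (α i)) :
    ∃ K : (Fin d → Fin n) → ℝ,
      IsPolyplex K ∧ ContainedIn K A ∧ plexWeight K = (n : ℝ) - 1 ∧
      ∀ γ : Fin d → Fin n, (∃ i, γ i = β i) → K γ = 0 := by
  rcases isEmpty_or_nonempty (Fin d) with hd | ⟨⟨i₀⟩⟩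
  · obtain ⟨K, hK, hKA, hKw⟩ := hδ.1
    refine ⟨K, hK, hKA, ?_, fun γ ⟨i, _⟩ => hd.elim i⟩
    simp only [Finset.univ_eq_empty, Finset.sum_empty] at hα
    linarith
  have hδ0 : 0 < δ := by
    obtain ⟨K, hK, hKA, hKw⟩ := hδ.1
    have h1 := hK.plexWeight_le i₀
    refine lt_of_le_of_ne (by linarith) fun h0 => hE.1 ⟨K, hK, hKA, ?_⟩
    linarith
  have hw := hΛ.coverWeight_le hδ
  have hAα : A α = 0 := by
    by_contra hne
    have := hΛ.1.2 α hne
    linarith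
  obtain ⟨K, hK, hKA, hKw, hKα⟩ := hE.exists_polyplex_avoiding hΛ.1 hδ0 hw i₀ hα hAα
  let e : (Fin d → Fin n) ≃ (Fin d → Fin n) :=
    Equiv.piCongrRight fun i => Equiv.swap (α i) (β i)
  have he : ∀ γ i, e γ i = Equiv.swap (α i) (β i) (γ i) := fun _ _ => rfl
  have hav : ∀ γ : Fin d → Fin n, (∃ i, γ i = β i) → K (e γ) = 0 := by
    rintro γ ⟨i, hi⟩
    exact hKα _ ⟨i, by rw [he, hi, Equiv.swap_apply_right]⟩
  refine ⟨fun γ => K (e γ), ⟨fun γ => hK.1 _, fun i j => ?_⟩, fun γ hγ => ?_, ?_, hav⟩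
  · refine le_trans (le_of_eq ?_) (hK.2 i (Equiv.swap (α i) (β i) j))
    rw [← Equiv.sum_comp e fun γ => if γ i = Equiv.swap (α i) (β i) j then K γ else 0]
    refine Finset.sum_congr rfl fun γ _ => ?_
    simp [he]
  · refine hE.ne_zero_of_one_le hΛ.1 (by linarith) ((hΛ.1.2 _ (hKA _ hγ)).trans ?_)
    refine Finset.sum_le_sum fun i _ => ?_
    rw [he]
    have hne : γ i ≠ β i := fun h => hγ (hav γ ⟨i, h⟩)
    by_cases h : γ i = α i
    · rw [h, Equiv.swap_apply_left]
      exact hle i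
    · rw [Equiv.swap_apply_of_ne_of_ne h hne]
  · rw [← hKw]
    exact Equiv.sum_comp e K
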